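/- arXiv:math/0603026 — 2 statements merged into one kernel-verified Lean document; each statement's English description precedes it below -/
import Mathlib

section
/- Let X be a Banach space, D ⊆ X a linear subspace, and d₁ : D → X a linear map. Let d₀ be a bounded linear operator on X mapping D into D and commuting with d₁ on D (d₁(d₀ w) = d₀(d₁ w) for all w ∈ D). Let V ⊆ D be a linear subspace with d₁(V) ⊆ V and such that d₁ is bounded on V, i.e. there is ρ ≥ 0 with ‖d₁ v‖ ≤ ρ‖v‖ for all v ∈ V. Then every v ∈ V is an analytic element for d = d₀ + d₁: v lies in the domain of every power dⁿ and for every z ∈ ℂ the series Σ_{n≥0} (|z|ⁿ/n!) ‖dⁿ v‖ converges. -/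
/-- Iterates of a map which is additive on an invariant set `s` are additive on `s`. -/
theorem iterate_add_of_mapsTo {X : Type*} [Add X] {f : X → X} {s : Set X}
    (hf : Set.MapsTo f s s) (hadd : ∀ u ∈ s, ∀ w ∈ s, f (u + w) = f u + f w) (n : ℕ) :
    ∀ u ∈ s, ∀ w ∈ s, f^[n] (u + w) = f^[n] u + f^[n] w := by
  induction n with
  | zero => intro u _ w _; rfl
  | succ n ih =>
    intro u hu w hw
    rw [Function.iterate_succ_apply', ih u hu w hw,
      hadd _ (hf.iterate n hu) _ (hf.iterate n hw),
      Function.iterate_succ_apply', Function.iterate_succ_apply']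

/-- A map commuting with `f` on an `f`-invariant set commutes with the iterates of `f` there. -/
theorem iterate_comm_of_mapsTo {X : Type*} {f g : X → X} {s : Set X}
    (hf : Set.MapsTo f s s) (hcomm : ∀ w ∈ s, f (g w) = g (f w)) (n : ℕ) :
    ∀ w ∈ s, f^[n] (g w) = g (f^[n] w) := by
  induction n with
  | zero => intro w _; rfl
  | succ n ih =>
    intro w hw
    rw [Function.iterate_succ_apply', ih w hw, hcomm _ (hf.iterate n hw),
      Function.iterate_succ_apply']

/-- If `d₀` is bounded and commutes with `d₁` on `D`, and `d₁` leaves `V ⊆ D` invariant, then `V`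
is contained in a subspace of `D` that both maps leave invariant. -/
theorem exists_invariant_submodule {X : Type*} [NormedAddCommGroup X] [NormedSpace ℂ X]
    (D : Submodule ℂ X) (d₁ : X → X)
    (hadd : ∀ u ∈ D, ∀ v ∈ D, d₁ (u + v) = d₁ u + d₁ v)
    (hsmul : ∀ (a : ℂ), ∀ u ∈ D, d₁ (a • u) = a • d₁ u)
    (d₀ : X →L[ℂ] X) (hd₀D : ∀ w ∈ D, d₀ w ∈ D)
    (hcomm : ∀ w ∈ D, d₁ (d₀ w) = d₀ (d₁ w))
    (V : Submodule ℂ X) (hVD : V ≤ D) (hVinv : ∀ v ∈ V, d₁ v ∈ V) :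
    ∃ M : Submodule ℂ X, V ≤ M ∧ M ≤ D ∧ (∀ w ∈ M, d₀ w ∈ M) ∧ ∀ w ∈ M, d₁ w ∈ M := by
  set s : Set X := {w | ∃ k : ℕ, ∃ v ∈ V, d₀^[k] v = w}
  have hsD : s ⊆ D := by
    rintro _ ⟨k, v, hv, rfl⟩
    exact Set.MapsTo.iterate (f := d₀) (s := D) hd₀D k (hVD hv)
  have hMD : Submodule.span ℂ s ≤ D := Submodule.span_le.2 hsD
  have hs₁ : ∀ k : ℕ, ∀ v ∈ V, d₁ (d₀^[k] v) = d₀^[k] (d₁ v) := by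
    intro k v hv
    exact (iterate_comm_of_mapsTo (f := d₀) (g := d₁) (s := D) hd₀D
      (fun w hw => (hcomm w hw).symm) k v (hVD hv)).symm
  refine ⟨Submodule.span ℂ s, fun v hv => Submodule.subset_span ⟨0, v, hv, rfl⟩, hMD, ?_, ?_⟩
  · intro w hw
    induction hw using Submodule.span_induction with
    | mem x hx =>
      obtain ⟨k, v, hv, rfl⟩ := hx
      exact Submodule.subset_span ⟨k + 1, v, hv, Function.iterate_succ_apply' _ _ _⟩
    | zero => simp
    | add x y _ _ hx hy => rw [map_add]; exact add_mem hx hy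
    | smul a x _ hx => rw [map_smul]; exact Submodule.smul_mem _ a hx
  · intro w hw
    induction hw using Submodule.span_induction with
    | mem x hx =>
      obtain ⟨k, v, hv, rfl⟩ := hx
      exact Submodule.subset_span ⟨k, d₁ v, hVinv v hv, (hs₁ k v hv).symm⟩
    | zero =>
      have h : d₁ 0 = 0 := by simpa using hsmul 0 0 D.zero_mem
      rw [h]; exact zero_mem _
    | add x y hxs hys hx hy => rw [hadd x (hMD hxs) y (hMD hys)]; exact add_mem hx hy
    | smul a x hxs hx => rw [hsmul a x (hMD hxs)]; exact Submodule.smul_mem _ a hx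

/-- Let `X` be a Banach space, `D ⊆ X` a linear subspace and `d₁` a linear map from
`D` to `X` (encoded as a function `d₁ : X → X` which is additive and homogeneous on
`D`; only its values on `D` matter).  Let `d₀` be a bounded linear operator on `X`
mapping `D` into `D` and commuting with `d₁` on `D`.  Let `V ⊆ D` be a linear
subspace with `d₁ (V) ⊆ V` and such that `d₁` is bounded on `V`: there is `ρ ≥ 0`
with `‖d₁ v‖ ≤ ρ * ‖v‖` for all `v ∈ V`.  Then every `v ∈ V` is an analytic
element for `d = d₀ + d₁`: `v` lies in the domain of every power `dⁿ` (the
iterates never leave `D`) and for every `z : ℂ` the series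
`Σ (|z|ⁿ/n!) ‖dⁿ v‖` converges. -/
theorem analytic_elements_of_commuting_perturbation
    {X : Type*} [NormedAddCommGroup X] [NormedSpace ℂ X] [CompleteSpace X]
    (D : Submodule ℂ X) (d₁ : X → X)
    (hadd : ∀ u ∈ D, ∀ v ∈ D, d₁ (u + v) = d₁ u + d₁ v)
    (hsmul : ∀ (a : ℂ), ∀ u ∈ D, d₁ (a • u) = a • d₁ u)
    (d₀ : X →L[ℂ] X)
    (hd₀D : ∀ w ∈ D, d₀ w ∈ D)
    (hcomm : ∀ w ∈ D, d₁ (d₀ w) = d₀ (d₁ w))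
    (V : Submodule ℂ X)
    (hVD : (V : Set X) ⊆ (D : Set X))
    (hVinv : ∀ v ∈ V, d₁ v ∈ V)
    (ρ : ℝ) (hρ : 0 ≤ ρ)
    (hbound : ∀ v ∈ V, ‖d₁ v‖ ≤ ρ * ‖v‖) :
    ∀ v ∈ V,
      (∀ n : ℕ, (fun w => d₀ w + d₁ w)^[n] v ∈ D) ∧
      ∀ z : ℂ,
        Summable (fun n : ℕ =>
          ‖z‖ ^ n / n.factorial * ‖(fun w => d₀ w + d₁ w)^[n] v‖) := by
  obtain ⟨M, hVM, hMD, hM₀, hM₁⟩ :=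
    exists_invariant_submodule D d₁ hadd hsmul d₀ hd₀D hcomm V hVD hVinv
  set d : X → X := fun w => d₀ w + d₁ w with hd
  have hdM : Set.MapsTo d M M := fun w hw => M.add_mem (hM₀ w hw) (hM₁ w hw)
  have hd_add : ∀ u ∈ (M : Set X), ∀ w ∈ (M : Set X), d (u + w) = d u + d w := by
    intro u hu w hw
    simp only [hd, map_add, hadd u (hMD hu) w (hMD hw)]
    abel
  have hd_comm : ∀ w ∈ (M : Set X), d (d₀ w) = d₀ (d w) := by
    intro w hw
    simp only [hd, map_add, hcomm w (hMD hw)]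
  have hnorm : ∀ n : ℕ, ∀ v ∈ V, ‖d^[n] v‖ ≤ (‖d₀‖ + ρ) ^ n * ‖v‖ := by
    intro n
    induction n with
    | zero => intro v _; simp
    | succ n ih =>
      intro v hv
      calc ‖d^[n + 1] v‖ = ‖d₀ (d^[n] v) + d^[n] (d₁ v)‖ := by
            rw [Function.iterate_succ_apply,
              iterate_add_of_mapsTo hdM hd_add n _ (hM₀ v (hVM hv)) _ (hM₁ v (hVM hv)),
              iterate_comm_of_mapsTo hdM hd_comm n v (hVM hv)]
        _ ≤ ‖d₀‖ * ‖d^[n] v‖ + ‖d^[n] (d₁ v)‖ :=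
            (norm_add_le _ _).trans (add_le_add_left (d₀.le_opNorm _) _)
        _ ≤ ‖d₀‖ * ((‖d₀‖ + ρ) ^ n * ‖v‖) + (‖d₀‖ + ρ) ^ n * (ρ * ‖v‖) := by
            gcongr
            · exact ih v hv
            · exact (ih _ (hVinv v hv)).trans
                (mul_le_mul_of_nonneg_left (hbound v hv) (by positivity))
        _ = (‖d₀‖ + ρ) ^ (n + 1) * ‖v‖ := by ring
  intro v hv
  refine ⟨fun n => hMD (hdM.iterate n (hVM hv)), fun z => ?_⟩
  refine Summable.of_nonneg_of_le (fun n => by positivity) (fun n => ?_)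
    ((Real.summable_pow_div_factorial (‖z‖ * (‖d₀‖ + ρ))).mul_right ‖v‖)
  calc ‖z‖ ^ n / n.factorial * ‖d^[n] v‖
      ≤ ‖z‖ ^ n / n.factorial * ((‖d₀‖ + ρ) ^ n * ‖v‖) :=
        mul_le_mul_of_nonneg_left (hnorm n v hv) (by positivity)
    _ = (‖z‖ * (‖d₀‖ + ρ)) ^ n / n.factorial * ‖v‖ := by rw [mul_pow]; ring
end

section
/- Let B be a C*-algebra, D ⊆ B a dense *-subalgebra, and d : D → B a *-derivation whose graph is closed in B × B. Let p ∈ D be a projection (p = p* = p²) with d(p) = 0, and suppose the corner pBp = {pbp : b ∈ B} is finite dimensional. Then pBp ⊆ D, d(pBp) ⊆ pBp, and every x ∈ pBp is an analytic element for d: for every z ∈ ℂ the series Σ_{n≥0} (zⁿ/n!) dⁿ x converges absolutely in B. -/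
/-- If `d` is linear on a finite-dimensional subspace `V` that it maps into itself, then the
exponential series of `d` at a point of `V` converges absolutely. -/
lemma summable_norm_iterate_of_finiteDimensional {E : Type*} [NormedAddCommGroup E]
    [NormedSpace ℂ E] (V : Submodule ℂ E) [FiniteDimensional ℂ V] (d : E → E)
    (hadd : ∀ x ∈ V, ∀ y ∈ V, d (x + y) = d x + d y)
    (hsmul : ∀ (c : ℂ), ∀ x ∈ V, d (c • x) = c • d x)
    (hmaps : ∀ x ∈ V, d x ∈ V) {x : E} (hx : x ∈ V) (r : ℝ) (hr : 0 ≤ r) :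
    Summable (fun n : ℕ => r ^ n / n.factorial * ‖d^[n] x‖) := by
  let T : V →ₗ[ℂ] E :=
    { toFun := fun v => d v
      map_add' := fun v w => hadd v v.2 w w.2
      map_smul' := fun c v => hsmul c v v.2 }
  let S : V →L[ℂ] E := LinearMap.toContinuousLinearMap T
  have hle : ∀ v ∈ V, ‖d v‖ ≤ ‖S‖ * ‖v‖ := fun v hv => S.le_opNorm ⟨v, hv⟩
  have hiter : ∀ n : ℕ, d^[n] x ∈ V ∧ ‖d^[n] x‖ ≤ ‖S‖ ^ n * ‖x‖ := by
    intro n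
    induction n with
    | zero => simpa using hx
    | succ n ih =>
      rw [Function.iterate_succ_apply']
      refine ⟨hmaps _ ih.1, (hle _ ih.1).trans ?_⟩
      rw [pow_succ', mul_assoc]
      gcongr
      exact ih.2
  refine Summable.of_nonneg_of_le (fun n => by positivity) (fun n => ?_)
    ((Real.summable_pow_div_factorial (r * ‖S‖)).mul_right ‖x‖)
  calc r ^ n / n.factorial * ‖d^[n] x‖
      ≤ r ^ n / n.factorial * (‖S‖ ^ n * ‖x‖) := by gcongr; exact (hiter n).2
    _ = (r * ‖S‖) ^ n / n.factorial * ‖x‖ := by ring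

/-- If the range of a continuous linear map is finite-dimensional, then a subspace that
contains the image of a dense set contains the whole range. -/
lemma LinearMap.range_le_of_dense_of_finiteDimensional {E F : Type*} [NormedAddCommGroup E]
    [NormedSpace ℂ E] [NormedAddCommGroup F] [NormedSpace ℂ F] (f : E →ₗ[ℂ] F)
    (hf : Continuous f) [FiniteDimensional ℂ (LinearMap.range f)] (W : Submodule ℂ F)
    {s : Set E} (hs : Dense s) (hsW : ∀ x ∈ s, f x ∈ W) : LinearMap.range f ≤ W := by
  have hfin : FiniteDimensional ℂ (LinearMap.range f ⊓ W : Submodule ℂ F) :=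
    Submodule.finiteDimensional_of_le (inf_le_left : LinearMap.range f ⊓ W ≤ LinearMap.range f)
  have hclosed : IsClosed ((LinearMap.range f ⊓ W : Submodule ℂ F) : Set F) :=
    Submodule.closed_of_finiteDimensional _
  rintro _ ⟨x, rfl⟩
  have hsub : closure s ⊆ f ⁻¹' ((LinearMap.range f ⊓ W : Submodule ℂ F) : Set F) :=
    closure_minimal (fun y hy => ⟨LinearMap.mem_range_self f y, hsW y hy⟩) (hclosed.preimage hf)
  exact (hsub (hs x)).2


/-- Let `B` be a C*-algebra, `D ⊆ B` a dense *-subalgebra, and `d` a *-derivation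
defined on `D` (encoded as a function `d : B → B` which on `D` is linear,
satisfies the Leibniz rule and commutes with the star operation; only its values
on `D` matter) whose graph `{(x, d x) : x ∈ D}` is closed in `B × B`.  Let
`p ∈ D` be a projection (`p = p*`, `p = p²`) with `d p = 0`, and suppose the
corner `pBp = {p * b * p : b ∈ B}` is a finite-dimensional complex vector space.
Then `pBp ⊆ D`, `d (pBp) ⊆ pBp`, and every `x ∈ pBp` is an analytic element for
`d`: for every `z : ℂ` the series `Σ (zⁿ/n!) dⁿ x` converges absolutely in `B`
(all powers `dⁿ x` being well defined since `pBp ⊆ D` is `d`-invariant). -/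
theorem closed_star_derivation_finite_dimensional_corner_analytic
    {B : Type*} [NonUnitalNormedRing B] [StarRing B] [CStarRing B]
    [NormedSpace ℂ B] [IsScalarTower ℂ B B] [SMulCommClass ℂ B B]
    [StarModule ℂ B] [CompleteSpace B]
    (D : NonUnitalStarSubalgebra ℂ B) (hdense : Dense (D : Set B))
    (d : B → B)
    (hadd : ∀ x ∈ D, ∀ y ∈ D, d (x + y) = d x + d y)
    (hsmul : ∀ (c : ℂ), ∀ x ∈ D, d (c • x) = c • d x)
    (hLeib : ∀ x ∈ D, ∀ y ∈ D, d (x * y) = d x * y + x * d y)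
    (hstar : ∀ x ∈ D, d (star x) = star (d x))
    (hgraph : IsClosed {q : B × B | q.1 ∈ D ∧ q.2 = d q.1})
    (p : B) (hpD : p ∈ D) (hpstar : star p = p) (hpidem : p * p = p)
    (hdp : d p = 0)
    (hfin : FiniteDimensional ℂ
      (LinearMap.range ((LinearMap.mulLeft ℂ p).comp (LinearMap.mulRight ℂ p)))) :
    (∀ b : B, (∃ a : B, b = p * a * p) → b ∈ D) ∧
      (∀ b : B, (∃ a : B, b = p * a * p) → ∃ a : B, d b = p * a * p) ∧
      ∀ x : B, (∃ a : B, x = p * a * p) → ∀ z : ℂ,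
        Summable (fun n : ℕ => ‖z‖ ^ n / n.factorial * ‖d^[n] x‖) := by
  set f := (LinearMap.mulLeft ℂ p).comp (LinearMap.mulRight ℂ p) with hf
  have hfapply : ∀ a, f a = p * a * p := fun a => by simp [hf, mul_assoc]
  have hmem : ∀ {x : B}, (∃ a : B, x = p * a * p) ↔ x ∈ LinearMap.range f := by
    intro x
    simp only [LinearMap.mem_range, hfapply, eq_comm]
  have hcont : Continuous f := by
    have : (f : B → B) = fun a => p * a * p := funext hfapply
    rw [this]
    fun_prop
  have hVD : ∀ x ∈ LinearMap.range f, x ∈ D :=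
    LinearMap.range_le_of_dense_of_finiteDimensional f hcont
      D.toNonUnitalSubalgebra.toSubmodule hdense fun a ha => by
        rw [hfapply]
        exact D.mul_mem (D.mul_mem hpD ha) hpD
  have hcorner : ∀ y ∈ D, d (p * y * p) = p * d y * p := by
    intro y hy
    rw [hLeib _ (D.mul_mem hpD hy) _ hpD, hLeib _ hpD _ hy, hdp]
    simp
  have hinv : ∀ x ∈ LinearMap.range f, d x = p * d x * p := by
    intro x hx
    have hpxp : p * x * p = x := by
      obtain ⟨a, rfl⟩ := hmem.2 hx
      simp only [mul_assoc, hpidem]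
      simp only [← mul_assoc, hpidem]
    rw [← hcorner x (hVD x hx), hpxp]
  refine ⟨fun b hb => hVD b (hmem.1 hb), fun b hb => ⟨d b, hinv b (hmem.1 hb)⟩,
    fun x hx z => ?_⟩
  exact summable_norm_iterate_of_finiteDimensional (LinearMap.range f) d
    (fun x hx y hy => hadd x (hVD x hx) y (hVD y hy)) (fun c x hx => hsmul c x (hVD x hx))
    (fun x hx => hmem.1 ⟨d x, hinv x hx⟩) (hmem.1 hx) ‖z‖ (norm_nonneg z)
end
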